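/- Let k be a field of characteristic zero and (R, Δ) a commutative differential k-algebra with R noetherian, dim_k R < |k|, and |Δ| < |k|. The following are equivalent: (i) R satisfies the Δ-Dixmier-Moeglin equivalence; (ii) every Δ-rational Δ-prime ideal of R is locally closed in Δ-spec R; (iii) every Δ-primitive ideal of R is locally closed in Δ-spec R; (iv) every Δ-prime ideal that is |k|-separable in Δ-spec R is ℵ₀-separable in Δ-spec R. -/

import Mathlib

universe u

section DifferentialAlgebra

variable (k R : Type u) [Field k] [CommRing R] [Algebra k R]

/-- `I` is a `Δ`-ideal: it is stable under every derivation in `Δ`. -/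
def IsDeltaIdeal (Δ : Set (Derivation k R R)) (I : Ideal R) : Prop :=
  ∀ δ ∈ Δ, ∀ x ∈ I, δ x ∈ I

/-- `P` is a `Δ`-prime ideal: a prime ideal which is a `Δ`-ideal. -/
def IsDeltaPrime (Δ : Set (Derivation k R R)) (P : Ideal R) : Prop :=
  P.IsPrime ∧ IsDeltaIdeal k R Δ P

/-- The `Δ`-core of an ideal `J`: the largest `Δ`-ideal contained in `J`. -/
def deltaCore (Δ : Set (Derivation k R R)) (J : Ideal R) : Ideal R :=
  sSup {I : Ideal R | IsDeltaIdeal k R Δ I ∧ I ≤ J}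

/-- `P` is `Δ`-primitive: it is the `Δ`-core of some maximal ideal. -/
def IsDeltaPrimitive (Δ : Set (Derivation k R R)) (P : Ideal R) : Prop :=
  ∃ M : Ideal R, M.IsMaximal ∧ deltaCore k R Δ M = P

/-- `Δ`-spec `R`: the set of `Δ`-prime ideals, topologized as a subspace of `Spec R`. -/
abbrev DeltaSpec (Δ : Set (Derivation k R R)) : Type u :=
  {P : PrimeSpectrum R // IsDeltaIdeal k R Δ P.asIdeal}

/-- `P` is `Δ`-rational: whenever `a, b ∈ R` with `b ∉ P` are such that the class of `a/b` in
`Frac(R/P)` is killed by all the induced derivations, that class is algebraic over `k`. -/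
def IsDeltaRational (Δ : Set (Derivation k R R)) (P : Ideal R) (hP : P.IsPrime) : Prop :=
  haveI := hP
  ∀ a b : R, b ∉ P → (∀ δ ∈ Δ, δ a * b - a * δ b ∈ P) →
    IsAlgebraic k
      (algebraMap (R ⧸ P) (FractionRing (R ⧸ P)) (Ideal.Quotient.mk P a) /
       algebraMap (R ⧸ P) (FractionRing (R ⧸ P)) (Ideal.Quotient.mk P b))

/-- `P` is `κ`-separable in `Δ`-spec `R`: there is a set `Λ`, of cardinality `< κ`, of `Δ`-prime
ideals properly containing `P`, such that every `Δ`-prime ideal properly containing `P` contains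
a member of `Λ`. -/
def DeltaSeparable (Δ : Set (Derivation k R R)) (κ : Cardinal.{u}) (P : Ideal R) : Prop :=
  ∃ Λ : Set (Ideal R), (∀ Q ∈ Λ, IsDeltaPrime k R Δ Q ∧ P < Q) ∧
    Cardinal.mk Λ < κ ∧
    ∀ Q : Ideal R, IsDeltaPrime k R Δ Q → P < Q → ∃ Q' ∈ Λ, Q' ≤ Q

/-- `R` satisfies the `Δ`-Dixmier–Moeglin equivalence: for every `Δ`-prime ideal `P`, the
conditions "`{P}` is locally closed in `Δ`-spec `R`", "`P` is `Δ`-primitive", and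
"`P` is `Δ`-rational" are equivalent. -/
def DeltaDME (Δ : Set (Derivation k R R)) : Prop :=
  ∀ (P : PrimeSpectrum R) (hP : IsDeltaIdeal k R Δ P.asIdeal),
    (IsLocallyClosed ({⟨P, hP⟩} : Set (DeltaSpec k R Δ)) ↔ IsDeltaPrimitive k R Δ P.asIdeal) ∧
    (IsDeltaPrimitive k R Δ P.asIdeal ↔ IsDeltaRational k R Δ P.asIdeal P.isPrime)

end DifferentialAlgebra

section DeltaIdeals

variable {k R : Type u} [Field k] [CommRing R] [Algebra k R] {Δ : Set (Derivation k R R)}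

/-- In characteristic zero, the minimal primes over a `Δ`-ideal are `Δ`-ideals. -/
theorem IsDeltaIdeal.of_mem_minimalPrimes [CharZero k] {I p : Ideal R}
    (hI : IsDeltaIdeal k R Δ I) (hp : p ∈ I.minimalPrimes) : IsDeltaIdeal k R Δ p := by
  intro δ hδ x hx
  have hprime : p.IsPrime := hp.1.1
  have hIp : I ≤ p := hp.1.2
  have key : ∀ n m : ℕ, ∀ s : R, s ∉ p → s * x ^ n * δ x ^ m ∈ I → δ x ∈ p := by
    intro n
    induction n with
    | zero =>
      intro m s hs h
      rw [pow_zero, mul_one] at h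
      exact hprime.mem_of_pow_mem _ ((hprime.mem_or_mem (hIp h)).resolve_left hs)
    | succ n ih =>
      intro m s hs h
      have hn : ((n + 1 : ℕ) : k) ≠ 0 := Nat.cast_ne_zero.mpr n.succ_ne_zero
      refine ih (m + 2) (s * s) (fun h' => hs ((hprime.mem_or_mem h').elim id id)) ?_
      have h1 := hI δ hδ _ h
      have h2 : ((n + 1 : ℕ) : R) * (s * s * x ^ n * δ x ^ (m + 2)) ∈ I := by
        rcases m with _ | m
        · have : ((n + 1 : ℕ) : R) * (s * s * x ^ n * δ x ^ (0 + 2)) =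
              s * δ x * δ (s * x ^ (n + 1) * δ x ^ 0) -
                δ s * δ x * (s * x ^ (n + 1) * δ x ^ 0) := by
            simp only [Derivation.leibniz, Derivation.leibniz_pow, smul_eq_mul, pow_zero,
              mul_one, nsmul_eq_mul, Nat.add_sub_cancel]
            ring
          rw [this]
          exact I.sub_mem (I.mul_mem_left _ h1) (I.mul_mem_left _ h)
        · have : ((n + 1 : ℕ) : R) * (s * s * x ^ n * δ x ^ (m + 1 + 2)) =
              s * δ x * δ (s * x ^ (n + 1) * δ x ^ (m + 1)) -
                (δ s * δ x + s * ((m + 1 : ℕ) : R) * δ (δ x)) *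
                  (s * x ^ (n + 1) * δ x ^ (m + 1)) := by
            simp only [Derivation.leibniz, Derivation.leibniz_pow, smul_eq_mul,
              nsmul_eq_mul, Nat.add_sub_cancel]
            ring
          rw [this]
          exact I.sub_mem (I.mul_mem_left _ h1) (I.mul_mem_left _ h)
      have h3 := I.mul_mem_left (algebraMap k R ((n + 1 : ℕ) : k)⁻¹) h2
      rwa [← mul_assoc, ← map_natCast (algebraMap k R), ← map_mul, inv_mul_cancel₀ hn, map_one,
        one_mul] at h3
  obtain ⟨s, hs, n, hn⟩ : ∃ s, s ∉ p ∧ ∃ n : ℕ, s * x ^ n ∈ I := by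
    by_contra! hcon
    let S : Submonoid R :=
      { carrier := {y | ∃ s, s ∉ p ∧ ∃ n : ℕ, y = s * x ^ n}
        one_mem' := ⟨1, fun h => hprime.ne_top ((Ideal.eq_top_iff_one p).2 h), 0, by simp⟩
        mul_mem' := by
          rintro _ _ ⟨s, hs, n, rfl⟩ ⟨t, ht, m, rfl⟩
          exact ⟨s * t, fun h => (hprime.mem_or_mem h).elim hs ht, n + m, by ring⟩ }
    have hdisj : Disjoint (I : Set R) S := by
      rw [Set.disjoint_left]
      rintro _ hy ⟨s, hs, n, rfl⟩
      exact hcon s hs n hy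
    obtain ⟨q, hq, hIq, hqS⟩ := Ideal.exists_le_prime_disjoint I S hdisj
    rw [Set.disjoint_left] at hqS
    have hqp : q ≤ p := fun y hy => by
      by_contra hyp
      exact hqS hy ⟨y, hyp, 0, by simp⟩
    exact hqS (hp.2 ⟨hq, hIq⟩ hqp hx)
      ⟨1, fun h => hprime.ne_top ((Ideal.eq_top_iff_one p).2 h), 1, by simp⟩
  exact key n 0 s hs (by simpa using hn)

theorem IsDeltaIdeal.sSup {s : Set (Ideal R)} (hs : ∀ I ∈ s, IsDeltaIdeal k R Δ I) :
    IsDeltaIdeal k R Δ (sSup s) := by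
  intro δ hδ x hx
  rw [sSup_eq_iSup'] at hx ⊢
  induction hx using Submodule.iSup_induction' with
  | mem I x hx => exact Submodule.mem_iSup_of_mem I (hs _ I.2 δ hδ x hx)
  | zero => simp
  | add x y _ _ hx hy => rw [map_add]; exact Submodule.add_mem _ hx hy

theorem isDeltaIdeal_deltaCore (J : Ideal R) : IsDeltaIdeal k R Δ (deltaCore k R Δ J) :=
  IsDeltaIdeal.sSup fun _ hI => hI.1

theorem deltaCore_le (J : Ideal R) : deltaCore k R Δ J ≤ J :=
  sSup_le fun _ hI => hI.2

theorem IsDeltaIdeal.le_deltaCore {I J : Ideal R} (hI : IsDeltaIdeal k R Δ I) (hIJ : I ≤ J) :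
    I ≤ deltaCore k R Δ J :=
  le_sSup ⟨hI, hIJ⟩

/-- In characteristic zero, the `Δ`-core of a prime ideal is `Δ`-prime. -/
theorem isDeltaPrime_deltaCore [CharZero k] (J : Ideal R) [J.IsPrime] :
    IsDeltaPrime k R Δ (deltaCore k R Δ J) := by
  obtain ⟨p, hp, hpJ⟩ := Ideal.exists_minimalPrimes_le (deltaCore_le (k := k) (Δ := Δ) J)
  have hpΔ := (isDeltaIdeal_deltaCore J).of_mem_minimalPrimes hp
  rw [le_antisymm hp.1.2 (hpΔ.le_deltaCore hpJ)]
  exact ⟨hp.1.1, hpΔ⟩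

theorem IsDeltaIdeal.foldr_mem {I : Ideal R} (hI : IsDeltaIdeal k R Δ I) (w : List Δ) {x : R}
    (hx : x ∈ I) : w.foldr (fun δ y => δ.1 y) x ∈ I := by
  induction w with
  | nil => exact hx
  | cons δ w ih => exact hI δ.1 δ.2 _ ih

/-- The smallest `Δ`-ideal containing a given set. -/
def deltaSpan (k : Type u) {R : Type u} [Field k] [CommRing R] [Algebra k R]
    (Δ : Set (Derivation k R R)) (s : Set R) : Ideal R :=
  sInf {I : Ideal R | IsDeltaIdeal k R Δ I ∧ s ⊆ I}

theorem isDeltaIdeal_deltaSpan (s : Set R) : IsDeltaIdeal k R Δ (deltaSpan k Δ s) := by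
  intro δ hδ x hx
  rw [deltaSpan, Submodule.mem_sInf] at hx ⊢
  exact fun I hI => hI.1 δ hδ x (hx I hI)

theorem subset_deltaSpan (s : Set R) : s ⊆ deltaSpan k Δ s := fun x hx => by
  rw [SetLike.mem_coe, deltaSpan, Submodule.mem_sInf]
  exact fun I hI => hI.2 hx

theorem deltaSpan_le {s : Set R} {I : Ideal R} (hI : IsDeltaIdeal k R Δ I) (hs : s ⊆ I) :
    deltaSpan k Δ s ≤ I :=
  sInf_le ⟨hI, hs⟩

/-- A `Δ`-prime ideal `P` is `κ`-separable iff fewer than `κ` elements outside `P` suffice to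
meet all the `Δ`-prime ideals properly containing `P`. -/
theorem deltaSeparable_iff [CharZero k] [IsNoetherianRing R] {κ : Cardinal.{u}}
    (hκ : Cardinal.aleph0 ≤ κ) {P : Ideal R} :
    DeltaSeparable k R Δ κ P ↔ ∃ T : Set R, (∀ t ∈ T, t ∉ P) ∧ Cardinal.mk T < κ ∧
      ∀ Q : Ideal R, IsDeltaPrime k R Δ Q → P < Q → ∃ t ∈ T, t ∈ Q := by
  constructor
  · rintro ⟨Λ, hΛ, hcard, hsep⟩
    have hex : ∀ Q : Λ, ∃ t ∈ Q.1, t ∉ P := fun Q => Set.exists_of_ssubset (hΛ Q.1 Q.2).2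
    choose f hfQ hfP using hex
    refine ⟨Set.range f, ?_, Cardinal.mk_range_le.trans_lt hcard, ?_⟩
    · rintro _ ⟨Q, rfl⟩
      exact hfP Q
    · intro Q hQ hPQ
      obtain ⟨Q', hQ', hle⟩ := hsep Q hQ hPQ
      exact ⟨f ⟨Q', hQ'⟩, ⟨_, rfl⟩, hle (hfQ ⟨Q', hQ'⟩)⟩
  · rintro ⟨T, hT, hcard, hsep⟩
    let m : T → Set (Ideal R) := fun t => (deltaSpan k Δ (insert t.1 (P : Set R))).minimalPrimes
    have hm : ∀ t, (m t).Finite := fun t => Ideal.finite_minimalPrimes_of_isNoetherianRing R _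
    refine ⟨⋃ t, m t, ?_, ?_, ?_⟩
    · intro Q hQ
      obtain ⟨t, ht⟩ := Set.mem_iUnion.1 hQ
      have hle := (subset_deltaSpan (k := k) (Δ := Δ) (insert t.1 (P : Set R))).trans ht.1.2
      refine ⟨⟨ht.1.1, (isDeltaIdeal_deltaSpan _).of_mem_minimalPrimes ht⟩, ?_⟩
      exact ⟨fun x hx => hle (Set.mem_insert_of_mem _ hx),
        fun h => hT t t.2 (h (hle (Set.mem_insert _ _)))⟩
    · rcases hκ.eq_or_lt with rfl | hκ'
      · have : Finite T := Cardinal.lt_aleph0_iff_finite.1 hcard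
        exact Cardinal.lt_aleph0_iff_set_finite.2 (Set.finite_iUnion hm)
      · refine (Cardinal.mk_iUnion_le m).trans_lt (Cardinal.mul_lt_of_lt hκ hcard ?_)
        refine lt_of_le_of_lt (ciSup_le' fun t => ?_) hκ'
        exact (Cardinal.lt_aleph0_iff_set_finite.2 (hm t)).le
    · intro Q hQ hPQ
      obtain ⟨t, ht, htQ⟩ := hsep Q hQ hPQ
      have hle : deltaSpan k Δ (insert t (P : Set R)) ≤ Q :=
        deltaSpan_le hQ.2 (Set.insert_subset htQ hPQ.le)
      have := hQ.1
      obtain ⟨p, hp, hpQ⟩ := Ideal.exists_minimalPrimes_le hle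
      exact ⟨p, Set.mem_iUnion.2 ⟨⟨t, ht⟩, hp⟩, hpQ⟩

/-- `{P}` is locally closed in `Δ`-spec `R` iff a single element outside `P` meets all the
`Δ`-prime ideals properly containing `P`. -/
theorem isLocallyClosed_singleton_iff (P : PrimeSpectrum R) (hP : IsDeltaIdeal k R Δ P.asIdeal) :
    IsLocallyClosed ({⟨P, hP⟩} : Set (DeltaSpec k R Δ)) ↔ ∃ t ∉ P.asIdeal,
      ∀ Q : Ideal R, IsDeltaPrime k R Δ Q → P.asIdeal < Q → t ∈ Q := by
  constructor
  · rintro ⟨_, _, ⟨U, hU, rfl⟩, hZ', hUZ⟩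
    obtain ⟨Z, hZ, rfl⟩ := isClosed_induced_iff.1 hZ'
    have hPmem : (⟨P, hP⟩ : DeltaSpec k R Δ) ∈ Subtype.val ⁻¹' U ∩ Subtype.val ⁻¹' Z :=
      hUZ ▸ rfl
    obtain ⟨_, ⟨t, rfl⟩, hPt, htU⟩ :=
      PrimeSpectrum.isTopologicalBasis_basic_opens.exists_subset_of_mem_open hPmem.1 hU
    refine ⟨t, hPt, fun Q hQ hPQ => ?_⟩
    by_contra htQ
    let Q' : PrimeSpectrum R := ⟨Q, hQ.1⟩
    have hspec : P ⤳ Q' := (PrimeSpectrum.le_iff_specializes _ _).1 hPQ.le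
    have : (⟨Q', hQ.2⟩ : DeltaSpec k R Δ) ∈ ({⟨P, hP⟩} : Set (DeltaSpec k R Δ)) := by
      rw [hUZ]
      exact ⟨htU htQ, hspec.mem_closed hZ hPmem.2⟩
    have hQP : Q' = P := congrArg Subtype.val this
    exact hPQ.ne (congrArg PrimeSpectrum.asIdeal hQP).symm
  · rintro ⟨t, htP, ht⟩
    refine ⟨Subtype.val ⁻¹' (PrimeSpectrum.basicOpen t : Set (PrimeSpectrum R)),
      Subtype.val ⁻¹' PrimeSpectrum.zeroLocus P.asIdeal,
      (PrimeSpectrum.basicOpen t).isOpen.preimage continuous_subtype_val,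
      (PrimeSpectrum.isClosed_zeroLocus _).preimage continuous_subtype_val, ?_⟩
    ext ⟨Q, hQ⟩
    constructor
    · rintro h
      obtain rfl : Q = P := congrArg Subtype.val h
      exact ⟨htP, fun _ h => h⟩
    · rintro ⟨h1, h2⟩
      have h2' : P.asIdeal ≤ Q.asIdeal := h2
      refine Subtype.ext (PrimeSpectrum.ext ?_)
      by_contra hne
      exact h1 (ht Q.asIdeal ⟨Q.2, hQ⟩ (lt_of_le_of_ne h2' (Ne.symm hne)))

theorem isLocallyClosed_singleton_iff_deltaSeparable [CharZero k] [IsNoetherianRing R]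
    (P : PrimeSpectrum R) (hP : IsDeltaIdeal k R Δ P.asIdeal) :
    IsLocallyClosed ({⟨P, hP⟩} : Set (DeltaSpec k R Δ)) ↔
      DeltaSeparable k R Δ Cardinal.aleph0 P.asIdeal := by
  rw [isLocallyClosed_singleton_iff, deltaSeparable_iff le_rfl]
  constructor
  · rintro ⟨t, htP, ht⟩
    exact ⟨{t}, by simpa using htP, by simp, fun Q hQ hPQ => ⟨t, rfl, ht Q hQ hPQ⟩⟩
  · rintro ⟨T, hT, hcard, hsep⟩
    have hfin : T.Finite := Cardinal.lt_aleph0_iff_set_finite.1 hcard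
    refine ⟨∏ t ∈ hfin.toFinset, t, fun h => ?_, fun Q hQ hPQ => ?_⟩
    · obtain ⟨t, ht, htP⟩ := (Ideal.IsPrime.prod_mem_iff (p := P.asIdeal)).1 h
      exact hT t (hfin.mem_toFinset.1 ht) htP
    · obtain ⟨t, ht, htQ⟩ := hsep Q hQ hPQ
      exact Ideal.mem_of_dvd _ (Finset.dvd_prod_of_mem _ (hfin.mem_toFinset.2 ht)) htQ

end DeltaIdeals

section Algebraicity

/-- A field extension of `k` of dimension less than `|k|` is algebraic. -/
theorem Algebra.IsAlgebraic.of_rank_lt_mk {k L : Type u} [Field k] [Field L] [Algebra k L]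
    (h : Module.rank k L < Cardinal.mk k) : Algebra.IsAlgebraic k L := by
  refine ⟨fun x => ?_⟩
  by_contra hx
  exact (Transcendental.linearIndependent_sub_inv hx).cardinal_le_rank.not_gt h

/-- The quotient by a maximal ideal of a `k`-algebra of dimension less than `|k|` is algebraic
over `k`. -/
theorem isAlgebraic_quotient_of_rank_lt_mk {k A : Type u} [Field k] [CommRing A] [Algebra k A]
    (h : Module.rank k A < Cardinal.mk k) (M : Ideal A) [M.IsMaximal] :
    Algebra.IsAlgebraic k (A ⧸ M) := by
  let := Ideal.Quotient.field M
  exact .of_rank_lt_mk ((LinearMap.rank_le_of_surjective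
    (Ideal.Quotient.mkₐ k M).toLinearMap (Ideal.Quotient.mkₐ_surjective k M)).trans_lt h)

theorem rank_localization_le {k A : Type u} [Field k] [CommRing A] [Algebra k A]
    (S : Submonoid A) :
    Module.rank k (Localization S) ≤ Module.rank k A * Cardinal.mk S := by
  let b := Module.Basis.ofVectorSpace k A
  let f : Module.Basis.ofVectorSpaceIndex k A × S → Localization S :=
    fun x => Localization.mk (b x.1) x.2
  have hspan : Submodule.span k (Set.range f) = ⊤ := by
    refine eq_top_iff.2 fun z _ => ?_
    induction z using Localization.induction_on with
    | H y =>
      obtain ⟨a, s⟩ := y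
      have ha : a ∈ Submodule.span k (Set.range b) := by rw [b.span_eq]; trivial
      induction ha using Submodule.span_induction with
      | mem x hx =>
        obtain ⟨i, rfl⟩ := hx
        exact Submodule.subset_span ⟨(i, s), rfl⟩
      | zero => rw [Localization.mk_zero]; exact zero_mem _
      | add x y _ _ hx hy =>
        rw [← Localization.add_mk_self]; exact add_mem (hx trivial) (hy trivial)
      | smul c x _ hx =>
        rw [← Localization.smul_mk]; exact Submodule.smul_mem _ c (hx trivial)
  calc Module.rank k (Localization S)
      = Module.rank k (Submodule.span k (Set.range f)) := by rw [hspan, rank_top]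
    _ ≤ Cardinal.mk (Set.range f) := rank_span_le _
    _ ≤ _ := Cardinal.mk_range_le
    _ = _ := by rw [Cardinal.mk_prod, Cardinal.lift_id, Cardinal.lift_id, b.mk_eq_rank'']

theorem mk_submonoidClosure_le {A : Type u} [CommMonoid A] (T : Set A) :
    Cardinal.mk (Submonoid.closure T) ≤ max Cardinal.aleph0 (Cardinal.mk T) := by
  refine le_trans ?_ (Cardinal.mk_list_le_max T)
  refine Cardinal.mk_le_of_surjective
    (f := fun l : List T => (⟨(l.map Subtype.val).prod, Submonoid.list_prod_mem _ ?_⟩ :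
      Submonoid.closure T)) ?_
  · intro x hx
    obtain ⟨y, -, rfl⟩ := List.mem_map.1 hx
    exact Submonoid.subset_closure y.2
  · rintro ⟨x, hx⟩
    obtain ⟨l, hl, rfl⟩ := Submonoid.exists_list_of_mem_closure hx
    exact ⟨l.attachWith _ hl, by simp⟩

/-- Fewer than `|k|` elements outside a prime ideal `P` can be avoided by a maximal ideal
containing `P`. -/
theorem exists_isMaximal_avoiding {k A : Type u} [Field k] [CharZero k] [CommRing A] [Algebra k A]
    (h : Module.rank k A < Cardinal.mk k) (P : Ideal A) [P.IsPrime] {T : Set A}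
    (hT : ∀ t ∈ T, t ∉ P) (hcard : Cardinal.mk T < Cardinal.mk k) :
    ∃ M : Ideal A, M.IsMaximal ∧ P ≤ M ∧ ∀ t ∈ T, t ∉ M := by
  have hinf : Cardinal.aleph0 ≤ Cardinal.mk k :=
    have : Infinite k := Infinite.of_injective _ (Nat.cast_injective (R := k))
    Cardinal.aleph0_le_mk k
  rcases hinf.eq_or_lt with hk | hk
  · rw [← hk, Module.rank_lt_aleph0_iff] at h
    have : IsArtinianRing A := IsArtinianRing.of_finite k A
    exact ⟨P, inferInstance, le_rfl, hT⟩
  · let S := Submonoid.closure T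
    have hS : Disjoint (S : Set A) (P : Set A) := by
      have : S ≤ P.primeCompl := Submonoid.closure_le.2 hT
      exact Set.disjoint_left.2 fun x hx => this hx
    have hrank : Module.rank k (Localization S) < Cardinal.mk k :=
      (rank_localization_le S).trans_lt
        (Cardinal.mul_lt_of_lt hinf h ((mk_submonoidClosure_le T).trans_lt (max_lt hk hcard)))
    have hne : P.map (algebraMap A (Localization S)) ≠ ⊤ :=
      (IsLocalization.isPrime_of_isPrime_disjoint S _ P inferInstance hS).ne_top
    obtain ⟨N, hN, hPN⟩ := Ideal.exists_le_maximal _ hne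
    have halg := isAlgebraic_quotient_of_rank_lt_mk hrank N
    let M := N.comap (algebraMap A (Localization S))
    have hinj : Function.Injective
        (Ideal.quotientMapₐ N (Algebra.algHom k A (Localization S)) le_rfl :
          (A ⧸ M) →ₐ[k] _) := Ideal.quotientMap_injective
    have : Algebra.IsIntegral k (A ⧸ M) := Algebra.IsIntegral.of_injective _ hinj
    have hM : M.IsMaximal := Ideal.Quotient.maximal_of_isField _
      (isField_of_isIntegral_of_isField' (Field.toIsField k))
    refine ⟨M, hM, Ideal.map_le_iff_le_comap.1 hPN, fun t ht htM => ?_⟩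
    exact hN.ne_top (Ideal.eq_top_of_isUnit_mem _ htM
      (IsLocalization.map_units (Localization S) ⟨t, Submonoid.subset_closure ht⟩))

end Algebraicity

section Primitive

variable {k R : Type u} [Field k] [CharZero k] [CommRing R] [Algebra k R]
  {Δ : Set (Derivation k R R)}

theorem DeltaSeparable.isDeltaPrimitive [IsNoetherianRing R]
    (hrank : Module.rank k R < Cardinal.mk k) {P : Ideal R}
    (hP : IsDeltaPrime k R Δ P) (hsep : DeltaSeparable k R Δ (Cardinal.mk k) P) :
    IsDeltaPrimitive k R Δ P := by
  have hinf : Cardinal.aleph0 ≤ Cardinal.mk k :=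
    have : Infinite k := Infinite.of_injective _ (Nat.cast_injective (R := k))
    Cardinal.aleph0_le_mk k
  obtain ⟨T, hT, hcard, hmeet⟩ := (deltaSeparable_iff hinf).1 hsep
  have := hP.1
  obtain ⟨M, hM, hPM, hTM⟩ := exists_isMaximal_avoiding hrank P hT hcard
  refine ⟨M, hM, ?_⟩
  by_contra hne
  obtain ⟨t, ht, htQ⟩ := hmeet _ (isDeltaPrime_deltaCore M)
    (lt_of_le_of_ne (hP.2.le_deltaCore hPM) (Ne.symm hne))
  exact hTM t ht (deltaCore_le M htQ)

end Primitive

section Constants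

variable {k K : Type u} [Field k] [Field K] [Algebra k K] {ι : Type u}

/-- The field of common constants of a family of derivations of a field. -/
def constantField (D : ι → Derivation k K K) : IntermediateField k K where
  carrier := {c | ∀ i, D i c = 0}
  mul_mem' ha hb i := by rw [Derivation.leibniz, ha i, hb i]; simp
  add_mem' ha hb i := by rw [map_add, ha i, hb i, add_zero]
  algebraMap_mem' c i := (D i).map_algebraMap c
  inv_mem' a ha i := by rw [Derivation.leibniz_inv, ha i, smul_zero]

theorem mem_constantField {D : ι → Derivation k K K} {c : K} :
    c ∈ constantField D ↔ ∀ i, D i c = 0 :=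
  Iff.rfl

/-- Composition of derivations along a word, as a map linear over the constants. -/
def derivWord (D : ι → Derivation k K K) : List ι → K →ₗ[constantField D] K
  | [] => LinearMap.id
  | i :: w =>
    { toFun := fun x => D i (derivWord D w x)
      map_add' := fun x y => by rw [map_add, map_add]
      map_smul' := fun c x => by
        rw [map_smul, IntermediateField.smul_def, smul_eq_mul, Derivation.leibniz,
          mem_constantField.1 c.2 i, smul_zero, add_zero]
        rfl }

theorem derivWord_cons (D : ι → Derivation k K K) (i : ι) (w : List ι) (x : K) :
    derivWord D (i :: w) x = D i (derivWord D w x) :=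
  rfl

/-- If `b` is linearly independent over the constants, then a vector orthogonal to all the
vectors of iterated derivatives of `b` vanishes. -/
theorem eq_zero_of_forall_sum_derivWord_eq_zero (D : ι → Derivation k K K) {n : Type u} [Fintype n]
    {b : n → K} (hb : LinearIndependent (constantField D) b) (c : n → K)
    (hc : ∀ w, ∑ j, c j * derivWord D w (b j) = 0) : c = 0 := by
  classical
  induction hN : (Finset.univ.filter fun j => c j ≠ 0).card using Nat.strong_induction_on
    generalizing c with
  | _ N ih =>
    by_contra hne
    obtain ⟨j₀, hj₀⟩ := Function.ne_iff.1 hne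
    have hj₀' : c j₀ ≠ 0 := hj₀
    let e : n → K := fun j => (c j₀)⁻¹ * c j
    have he : ∀ w, ∑ j, e j * derivWord D w (b j) = 0 := fun w => by
      simp only [e, mul_assoc, ← Finset.mul_sum, hc w, mul_zero]
    have he₀ : e j₀ = 1 := inv_mul_cancel₀ hj₀'
    have hconst : ∀ i, (fun j => D i (e j)) = 0 := fun i => by
      refine ih _ ?_ _ (fun w => ?_) rfl
      · rw [← hN]
        refine Finset.card_lt_card ⟨fun j hj => ?_, fun hsub => ?_⟩
        · simp only [Finset.mem_filter, Finset.mem_univ, true_and] at hj ⊢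
          intro h
          simp [e, h] at hj
        · have := hsub (Finset.mem_filter.2 ⟨Finset.mem_univ j₀, hj₀'⟩)
          simp [he₀] at this
      · have h1 := congrArg (D i) (he w)
        have h2 := he (i :: w)
        simp only [map_sum, Derivation.leibniz, smul_eq_mul, map_zero, Finset.sum_add_distrib]
          at h1
        simp only [derivWord_cons] at h2
        rw [h2, zero_add] at h1
        rw [← h1]
        exact Finset.sum_congr rfl fun j _ => mul_comm _ _
    have := Fintype.linearIndependent_iff.1 hb
      (fun j => ⟨e j, fun i => congrFun (hconst i) j⟩) (he []) j₀
    exact one_ne_zero (he₀.symm.trans (congrArg Subtype.val this))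

/-- If `b` is linearly independent over the constants, then each coordinate functional of its
span is a linear differential operator. -/
theorem exists_finsupp_sum_derivWord (D : ι → Derivation k K K) {n : Type u} [Fintype n]
    [DecidableEq n] {b : n → K} (hb : LinearIndependent (constantField D) b) (i : n) :
    ∃ l : List ι →₀ K, ∀ j, (l.sum fun w a => a * derivWord D w (b j)) = if j = i then 1 else 0 := by
  let v : List ι → n → K := fun w j => derivWord D w (b j)
  have hspan : Submodule.span K (Set.range v) = ⊤ := by
    by_contra hne
    obtain ⟨f, hf, hle⟩ := Submodule.exists_le_ker_of_lt_top _ (lt_top_iff_ne_top.2 hne)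
    have hfv : ∀ x : n → K, f x = ∑ j, f (Pi.single j 1) * x j := fun x => by
      rw [LinearMap.pi_apply_eq_sum_univ f x]
      refine Finset.sum_congr rfl fun j _ => ?_
      rw [smul_eq_mul, mul_comm]
      congr 2
      ext j'
      simp [Pi.single_apply, eq_comm]
    have h0 := eq_zero_of_forall_sum_derivWord_eq_zero D hb (fun j => f (Pi.single j 1))
      fun w => (hfv (v w)).symm.trans (hle (Submodule.subset_span ⟨w, rfl⟩))
    refine hf (LinearMap.ext fun x => ?_)
    rw [hfv]
    exact Finset.sum_eq_zero fun j _ => by rw [congrFun h0 j]; exact zero_mul _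
  obtain ⟨l, hl⟩ := (Finsupp.mem_span_range_iff_exists_finsupp (R := K) (v := v)
    (x := Pi.single i 1)).1 (hspan ▸ trivial)
  refine ⟨l, fun j => ?_⟩
  have := congrFun hl j
  rw [Finsupp.sum, Finset.sum_apply] at this
  rw [Pi.single_apply] at this
  exact this

end Constants

section Extension

variable {k R : Type u} [Field k] [CommRing R] [Algebra k R]

/-- A derivation preserving a prime ideal `P` extends to the field of fractions of `R ⧸ P`. -/
theorem exists_derivation_fractionRing (P : Ideal R) [P.IsPrime] (δ : Derivation k R R)
    (hδ : ∀ x ∈ P, δ x ∈ P) :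
    ∃ D : Derivation k (FractionRing (R ⧸ P)) (FractionRing (R ⧸ P)),
      ∀ x, D (algebraMap R _ x) = algebraMap R _ (δ x) := by
  let K := FractionRing (R ⧸ P)
  let f : R →ₐ[k] TrivSqZeroExt K K :=
    { toFun := fun x => TrivSqZeroExt.inl (algebraMap R K x) +
        TrivSqZeroExt.inr (algebraMap R K (δ x))
      map_one' := by simp
      map_mul' := fun x y => by
        ext <;> simp <;> ring
      map_zero' := by simp
      map_add' := fun x y => by ext <;> simp <;> ring
      commutes' := fun c => by
        ext
        · simp [← IsScalarTower.algebraMap_apply, TrivSqZeroExt.algebraMap_eq_inl']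
        · simp [TrivSqZeroExt.algebraMap_eq_inl'] }
  have hker : ∀ x ∈ P, algebraMap R K x = 0 := fun x hx => by
    rw [IsScalarTower.algebraMap_apply R (R ⧸ P) K, Ideal.Quotient.algebraMap_eq,
      Ideal.Quotient.eq_zero_iff_mem.2 hx, map_zero]
  let g : (R ⧸ P) →ₐ[k] TrivSqZeroExt K K := Ideal.Quotient.liftₐ P f fun x hx => by
    ext <;> simp [f, hker x hx, hker _ (hδ x hx)]
  have hfst : ∀ y, (g y).fst = algebraMap _ K y := fun y => by
    obtain ⟨x, rfl⟩ := Ideal.Quotient.mk_surjective y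
    simp [g, f, IsScalarTower.algebraMap_apply R (R ⧸ P) K]
  have hunit : ∀ y : nonZeroDivisors (R ⧸ P), IsUnit (g y) := fun y => by
    rw [TrivSqZeroExt.isUnit_iff_isUnit_fst, hfst]
    exact IsLocalization.map_units K y
  let h : K →ₐ[k] TrivSqZeroExt K K :=
    IsLocalization.liftAlgHom (M := nonZeroDivisors (R ⧸ P)) hunit
  have hh : ∀ y, h (algebraMap _ K y) = g y := fun y => IsLocalization.lift_eq _ y
  have hhfst : ∀ z, (h z).fst = z := by
    have : (TrivSqZeroExt.fstHom k K K).toRingHom.comp h.toRingHom = RingHom.id K := by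
      refine IsLocalization.ringHom_ext (nonZeroDivisors (R ⧸ P)) (RingHom.ext fun y => ?_)
      exact (congrArg TrivSqZeroExt.fst (hh y)).trans (hfst y)
    exact fun z => congrArg (fun φ : K →+* K => φ z) this
  refine ⟨Derivation.mk' ((TrivSqZeroExt.sndHom K K).restrictScalars k ∘ₗ h.toLinearMap) ?_, ?_⟩
  · intro a b
    simp [hhfst, mul_comm]
  · intro x
    have := hh (Ideal.Quotient.mk P x)
    rw [IsScalarTower.algebraMap_apply R (R ⧸ P) K]
    exact (congrArg TrivSqZeroExt.snd this).trans (by simp [g, f]; rfl)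

end Extension

section Rational

variable {k R : Type u} [Field k] [CommRing R] [Algebra k R] {Δ : Set (Derivation k R R)}
  {P : Ideal R}

/-- Clearing denominators in the value of a polynomial at a fraction, uniformly in the algebra
where the fraction lives. -/
theorem pow_mul_aeval_eq_algebraMap_sum {L : Type u} [CommRing L] [Algebra k L] [Algebra R L]
    [IsScalarTower k R L] (p : Polynomial k) {d e : R} {z : L}
    (hz : algebraMap R L d * z = algebraMap R L e) :
    algebraMap R L d ^ p.natDegree * Polynomial.aeval z p =
      algebraMap R L (∑ i ∈ Finset.range (p.natDegree + 1),
        p.coeff i • (e ^ i * d ^ (p.natDegree - i))) := by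
  rw [Polynomial.aeval_eq_sum_range, Finset.mul_sum, map_sum]
  refine Finset.sum_congr rfl fun i hi => ?_
  have hsmul : ∀ (a : k) (x : R), algebraMap R L (a • x) = a • algebraMap R L x :=
    map_smul (IsScalarTower.toAlgHom k R L)
  rw [hsmul, map_mul, map_pow, map_pow, ← hz, mul_smul_comm]
  congr 1
  rw [← Nat.sub_add_cancel (Nat.lt_succ_iff.1 (Finset.mem_range.1 hi)), pow_add]
  simp only [Nat.add_sub_cancel]
  ring

variable (P) in
theorem algebraMap_fractionRing_quotient_eq_zero_iff {x : R} :
    algebraMap R (FractionRing (R ⧸ P)) x = 0 ↔ x ∈ P := by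
  rw [IsScalarTower.algebraMap_apply R (R ⧸ P), FaithfulSMul.algebraMap_eq_zero_iff,
    Ideal.Quotient.algebraMap_eq, Ideal.Quotient.eq_zero_iff_mem]

variable (P) in
theorem algebraMap_fractionRing_quotient_eq_iff {x y : R} :
    algebraMap R (FractionRing (R ⧸ P)) x = algebraMap R _ y ↔ x - y ∈ P := by
  rw [← algebraMap_fractionRing_quotient_eq_zero_iff P, map_sub, sub_eq_zero]

variable [P.IsPrime]

/-- The derivation of the field of fractions of `R ⧸ P` induced by a member of `Δ`. -/
noncomputable def deltaFrac (hP : IsDeltaIdeal k R Δ P) (δ : Δ) :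
    Derivation k (FractionRing (R ⧸ P)) (FractionRing (R ⧸ P)) :=
  (exists_derivation_fractionRing P δ.1 (hP δ.1 δ.2)).choose

theorem deltaFrac_algebraMap (hP : IsDeltaIdeal k R Δ P) (δ : Δ) (x : R) :
    deltaFrac hP δ (algebraMap R _ x) = algebraMap R _ (δ.1 x) :=
  (exists_derivation_fractionRing P δ.1 (hP δ.1 δ.2)).choose_spec x

theorem exists_mul_eq_algebraMap_fractionRing_quotient (z : FractionRing (R ⧸ P)) :
    ∃ a b : R, b ∉ P ∧ algebraMap R _ b * z = algebraMap R _ a := by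
  obtain ⟨a, b, hb, rfl⟩ := IsFractionRing.div_surjective (A := R ⧸ P) z
  obtain ⟨a, rfl⟩ := Ideal.Quotient.mk_surjective a
  obtain ⟨b, rfl⟩ := Ideal.Quotient.mk_surjective b
  have hb' : b ∉ P := fun h =>
    nonZeroDivisors.ne_zero hb (Ideal.Quotient.eq_zero_iff_mem.2 h)
  refine ⟨a, b, hb', ?_⟩
  have := (algebraMap_fractionRing_quotient_eq_zero_iff P).not.2 hb'
  exact mul_div_cancel₀ _ this

theorem isDeltaRational_iff (hP : IsDeltaIdeal k R Δ P) :
    IsDeltaRational k R Δ P ‹_› ↔ ∀ c ∈ constantField (deltaFrac hP), IsAlgebraic k c := by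
  have hdiv : ∀ a b : R, b ∉ P → ((∀ δ ∈ Δ, δ a * b - a * δ b ∈ P) ↔
      (algebraMap R (FractionRing (R ⧸ P)) a / algebraMap R _ b) ∈
        constantField (deltaFrac hP)) := fun a b hb => by
    have hb' := (algebraMap_fractionRing_quotient_eq_zero_iff P).not.2 hb
    rw [mem_constantField, Subtype.forall]
    refine forall₂_congr fun δ hδ => ?_
    rw [Derivation.leibniz_div, deltaFrac_algebraMap, deltaFrac_algebraMap, smul_eq_mul,
      mul_eq_zero, or_iff_right (pow_ne_zero _ (inv_ne_zero hb')), smul_eq_mul, smul_eq_mul,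
      ← map_mul, ← map_mul, ← map_sub, algebraMap_fractionRing_quotient_eq_zero_iff,
      mul_comm b]
  constructor
  · intro h c hc
    obtain ⟨a, b, hb, hab⟩ := exists_mul_eq_algebraMap_fractionRing_quotient c
    have hb' := (algebraMap_fractionRing_quotient_eq_zero_iff P).not.2 hb
    obtain rfl : algebraMap R _ a / algebraMap R _ b = c := by
      rw [← hab, mul_div_cancel_left₀ _ hb']
    exact h a b hb ((hdiv a b hb).2 hc)
  · exact fun h a b hb hab => h _ ((hdiv a b hb).1 hab)

/-- If `P` is the `Δ`-core of `M`, then every constant has a denominator outside `M`. -/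
theorem exists_denominator_of_mem_constantField (hP : IsDeltaIdeal k R Δ P) {M : Ideal R}
    (hM : deltaCore k R Δ M = P) {c : FractionRing (R ⧸ P)}
    (hc : c ∈ constantField (deltaFrac hP)) :
    ∃ e d : R, d ∉ M ∧ algebraMap R _ d * c = algebraMap R _ e := by
  let I : Ideal R :=
    { carrier := {d | ∃ e, algebraMap R _ d * c = algebraMap R _ e}
      add_mem' := by
        rintro a b ⟨e, he⟩ ⟨f, hf⟩
        exact ⟨e + f, by rw [map_add, map_add, add_mul, he, hf]⟩
      zero_mem' := ⟨0, by simp⟩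
      smul_mem' := by
        rintro a b ⟨e, he⟩
        exact ⟨a * e, by rw [smul_eq_mul, map_mul, map_mul, mul_assoc, he]⟩ }
  have hI : IsDeltaIdeal k R Δ I := by
    rintro δ hδ d ⟨e, he⟩
    refine ⟨δ e, ?_⟩
    have := congrArg (deltaFrac hP ⟨δ, hδ⟩) he
    rwa [Derivation.leibniz, mem_constantField.1 hc, smul_zero, zero_add, deltaFrac_algebraMap,
      deltaFrac_algebraMap, smul_eq_mul, mul_comm] at this
  obtain ⟨a, b, hb, hab⟩ := exists_mul_eq_algebraMap_fractionRing_quotient c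
  by_contra! hcon
  refine hb (hM ▸ hI.le_deltaCore (fun d hd => ?_) ⟨a, hab⟩)
  obtain ⟨e, he⟩ := hd
  by_contra hdM
  exact hcon e d hdM he

theorem IsDeltaPrimitive.isDeltaRational (hrank : Module.rank k R < Cardinal.mk k)
    (hP : IsDeltaIdeal k R Δ P) (hprim : IsDeltaPrimitive k R Δ P) :
    IsDeltaRational k R Δ P ‹_› := by
  obtain ⟨M, hM, hMP⟩ := hprim
  have halg := isAlgebraic_quotient_of_rank_lt_mk hrank M
  have hPM : P ≤ M := hMP ▸ deltaCore_le M
  rw [isDeltaRational_iff hP]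
  intro c hc
  obtain ⟨e, d, hd, hde⟩ := exists_denominator_of_mem_constantField hP hMP hc
  obtain ⟨z, hz⟩ : ∃ z : R ⧸ M, algebraMap R _ d * z = algebraMap R _ e := by
    have hd' : Ideal.Quotient.mk M d ≠ 0 := fun h => hd (Ideal.Quotient.eq_zero_iff_mem.1 h)
    obtain ⟨y, hy⟩ := Ideal.Quotient.exists_inv hd'
    exact ⟨y * Ideal.Quotient.mk M e, by
      rw [← mul_assoc, Ideal.Quotient.algebraMap_eq, hy, one_mul]⟩
  obtain ⟨p, hp, hpz⟩ := halg.isAlgebraic z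
  refine ⟨p, hp, ?_⟩
  by_contra hne
  have hconst : Polynomial.aeval c p ∈ constantField (deltaFrac hP) :=
    fun δ => by rw [Derivation.map_aeval, hc δ, smul_zero]
  obtain ⟨e', d', hd', hde'⟩ := exists_denominator_of_mem_constantField hP hMP
    (inv_mem hconst)
  have h1 := pow_mul_aeval_eq_algebraMap_sum p hz
  have h2 := pow_mul_aeval_eq_algebraMap_sum p hde
  set x := ∑ i ∈ Finset.range (p.natDegree + 1), p.coeff i • (e ^ i * d ^ (p.natDegree - i))
  rw [hpz, mul_zero, Ideal.Quotient.algebraMap_eq, eq_comm, Ideal.Quotient.eq_zero_iff_mem] at h1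
  have h3 : d' * d ^ p.natDegree - e' * x ∈ P := by
    rw [← algebraMap_fractionRing_quotient_eq_iff, map_mul, map_mul, map_pow, ← h2, ← hde']
    field_simp
  have h4 : d' * d ^ p.natDegree ∈ M :=
    (Submodule.sub_mem_iff_left _ (M.mul_mem_left e' h1)).1 (hPM h3)
  exact (hM.isPrime.mem_or_mem h4).elim hd' fun h => hd (hM.isPrime.mem_of_pow_mem _ h)

/-- If `c ≠ 0` is algebraic and `d * c ∈ Q` modulo `P ≤ Q`, then `d ∈ Q`. -/
theorem mem_of_mul_eq_algebraMap_of_isAlgebraic {Q : Ideal R} [Q.IsPrime] (hPQ : P ≤ Q)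
    {c : FractionRing (R ⧸ P)} (hc0 : c ≠ 0) (hc : IsAlgebraic k c) {d y : R} (hy : y ∈ Q)
    (hdc : algebraMap R _ d * c = algebraMap R _ y) : d ∈ Q := by
  obtain ⟨p, hp, hp0⟩ := hc.inv.isIntegral
  rw [← Polynomial.aeval_def] at hp0
  have hyd : algebraMap R _ y * c⁻¹ = algebraMap R _ d := by
    rw [← hdc, mul_assoc, mul_inv_cancel₀ hc0, mul_one]
  have h := pow_mul_aeval_eq_algebraMap_sum p hyd
  rw [hp0, mul_zero, eq_comm, algebraMap_fractionRing_quotient_eq_zero_iff,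
    Finset.sum_range_succ, hp.coeff_natDegree, Nat.sub_self, pow_zero, mul_one, one_smul] at h
  refine ‹Q.IsPrime›.mem_of_pow_mem p.natDegree ?_
  refine (Submodule.add_mem_iff_right _ (Submodule.sum_mem _ fun i hi => ?_)).1 (hPQ h)
  refine Submodule.smul_of_tower_mem Q _ (Q.mul_mem_left _ (Q.pow_mem_of_mem hy _ ?_))
  exact Nat.sub_pos_of_lt (Finset.mem_range.1 hi)

/-- For finitely many elements linearly independent over the constants, a single element outside
`P` lies in all the `Δ`-primes above `P` containing an algebraic-constant combination of them
with nonzero `i`-th coefficient. -/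
theorem exists_notMem_forall_mem_of_linearIndependent (hP : IsDeltaIdeal k R Δ P) {n : Type u}
    [Fintype n] {b : n → FractionRing (R ⧸ P)}
    (hb : LinearIndependent (constantField (deltaFrac hP)) b) (i : n) :
    ∃ d ∉ P, ∀ Q : Ideal R, IsDeltaPrime k R Δ Q → P ≤ Q → ∀ q ∈ Q,
      ∀ c : n → constantField (deltaFrac hP), algebraMap R _ q = ∑ j, c j • b j →
        c i ≠ 0 → IsAlgebraic k (c i : FractionRing (R ⧸ P)) → d ∈ Q := by
  classical
  obtain ⟨l, hl⟩ := exists_finsupp_sum_derivWord (deltaFrac hP) hb i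
  obtain ⟨d, hd⟩ := IsLocalization.exist_integer_multiples (nonZeroDivisors (R ⧸ P)) l.support l
  obtain ⟨d₀, hd₀⟩ := Ideal.Quotient.mk_surjective (d : R ⧸ P)
  have hr : ∀ w, ∃ r : R, algebraMap R (FractionRing (R ⧸ P)) d₀ * l w = algebraMap R _ r := by
    intro w
    by_cases hw : w ∈ l.support
    · obtain ⟨r, hr⟩ := hd w hw
      obtain ⟨r, rfl⟩ := Ideal.Quotient.mk_surjective r
      refine ⟨r, ?_⟩
      rw [IsScalarTower.algebraMap_apply R (R ⧸ P), IsScalarTower.algebraMap_apply R (R ⧸ P) _ r,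
        Ideal.Quotient.algebraMap_eq, hr, hd₀, Algebra.smul_def]
    · exact ⟨0, by simp [Finsupp.notMem_support_iff.1 hw]⟩
  choose r hr using hr
  refine ⟨d₀, fun h => nonZeroDivisors.ne_zero d.2 ?_, ?_⟩
  · rw [← hd₀, Ideal.Quotient.eq_zero_iff_mem.2 h]
  intro Q hQ hPQ q hq c hqc hci hcalg
  have hword : ∀ w : List Δ, derivWord (deltaFrac hP) w (algebraMap R _ q) =
      algebraMap R _ (w.foldr (fun δ y => δ.1 y) q) := fun w => by
    induction w with
    | nil => rfl
    | cons δ w ih => rw [derivWord_cons, ih, deltaFrac_algebraMap, List.foldr_cons]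
  have hcoeff : (c i : FractionRing (R ⧸ P)) =
      ∑ w ∈ l.support, l w * algebraMap R _ (w.foldr (fun δ y => δ.1 y) q) := by
    simp only [← hword, hqc, map_sum, map_smul, Finset.mul_sum]
    rw [Finset.sum_comm]
    have hj : ∀ j, ∑ w ∈ l.support, l w * c j • derivWord (deltaFrac hP) w (b j) =
        if j = i then (c j : FractionRing (R ⧸ P)) else 0 := fun j => by
      simp only [mul_smul_comm, ← Finset.smul_sum]
      have := hl j
      rw [Finsupp.sum] at this
      rw [this, IntermediateField.smul_def]
      simp
    simp only [hj]
    simp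
  have := hQ.1
  refine mem_of_mul_eq_algebraMap_of_isAlgebraic hPQ
    (y := ∑ w ∈ l.support, r w * w.foldr (fun δ y => δ.1 y) q) ?_ hcalg ?_ ?_
  · simpa using hci
  · exact Submodule.sum_mem _ fun w _ => Q.mul_mem_left _ (hQ.2.foldr_mem w hq)
  · rw [hcoeff, Finset.mul_sum, map_sum]
    exact Finset.sum_congr rfl fun w _ => by rw [← mul_assoc, hr, map_mul]

theorem IsDeltaRational.deltaSeparable [CharZero k] [IsNoetherianRing R]
    (hrank : Module.rank k R < Cardinal.mk k) (hP : IsDeltaIdeal k R Δ P)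
    (hrat : IsDeltaRational k R Δ P ‹_›) : DeltaSeparable k R Δ (Cardinal.mk k) P := by
  have hinf : Cardinal.aleph0 ≤ Cardinal.mk k :=
    have : Infinite k := Infinite.of_injective _ (Nat.cast_injective (R := k))
    Cardinal.aleph0_le_mk k
  rw [isDeltaRational_iff hP] at hrat
  rw [deltaSeparable_iff hinf]
  let K := FractionRing (R ⧸ P)
  let C := constantField (deltaFrac hP)
  let β := Module.Basis.ofVectorSpace k R
  obtain ⟨B, hBs, hBspan, hB⟩ :=
    exists_linearIndependent C (Set.range fun i => algebraMap R K (β i))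
  have hBcard : Cardinal.mk B < Cardinal.mk k :=
    ((Cardinal.mk_le_mk_of_subset hBs).trans Cardinal.mk_range_le).trans_lt
      (β.mk_eq_rank''.trans_lt hrank)
  have hmem : ∀ q : R, algebraMap R K q ∈ Submodule.span C B := fun q => by
    rw [hBspan]
    have hq : q ∈ Submodule.span k (Set.range β) := by rw [β.span_eq]; trivial
    induction hq using Submodule.span_induction with
    | mem x hx =>
      obtain ⟨i, rfl⟩ := hx
      exact Submodule.subset_span ⟨i, rfl⟩
    | zero => rw [map_zero]; exact zero_mem _
    | add x y _ _ hx hy => rw [map_add]; exact add_mem hx hy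
    | smul a x _ hx =>
      have hsmul : algebraMap R K (a • x) = a • algebraMap R K x :=
        map_smul (IsScalarTower.toAlgHom k R K) a x
      rw [hsmul]
      exact Submodule.smul_of_tower_mem _ a hx
  have hd := fun x : Σ F : Finset B, F =>
    exists_notMem_forall_mem_of_linearIndependent hP
      (hB.comp (fun j : x.1 => j.1) Subtype.val_injective) x.2
  choose d hdP hd using hd
  refine ⟨Set.range d, ?_, Cardinal.mk_range_le.trans_lt ?_, ?_⟩
  · rintro _ ⟨x, rfl⟩
    exact hdP x
  · have hle : Cardinal.mk (Σ F : Finset B, F) ≤ Cardinal.mk (Finset B × B) :=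
      Cardinal.mk_le_of_injective (f := fun x => (x.1, x.2.1)) (by
        rintro ⟨F, i⟩ ⟨G, j⟩ h
        obtain ⟨rfl, h⟩ := Prod.mk.inj h
        exact congrArg (Sigma.mk F) (Subtype.ext h))
    refine hle.trans_lt ?_
    rcases finite_or_infinite B with h | h
    · exact (Cardinal.lt_aleph0_of_finite _).trans_le hinf
    · rw [Cardinal.mk_prod, Cardinal.lift_id, Cardinal.lift_id, Cardinal.mk_finset_of_infinite]
      exact Cardinal.mul_lt_of_lt hinf hBcard hBcard
  · intro Q hQ hPQ
    obtain ⟨q, hqQ, hqP⟩ := Set.exists_of_ssubset hPQ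
    obtain ⟨c, hc⟩ := (Finsupp.mem_span_iff_linearCombination C B _).1 (hmem q)
    have hc0 : c ≠ 0 := by
      rintro rfl
      rw [map_zero] at hc
      exact hqP ((algebraMap_fractionRing_quotient_eq_zero_iff P).1 hc.symm)
    obtain ⟨i, hi⟩ := Finsupp.support_nonempty_iff.2 hc0
    refine ⟨_, ⟨⟨c.support, ⟨i, hi⟩⟩, rfl⟩, ?_⟩
    refine hd ⟨c.support, ⟨i, hi⟩⟩ Q hQ hPQ.le q hqQ (fun j => c j.1) ?_
      (Finsupp.mem_support_iff.1 hi) (hrat _ (c i).2)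
    rw [← hc, Finsupp.linearCombination_apply, Finsupp.sum, ← Finset.sum_coe_sort]
    rfl

end Rational

/-- Topological characterizations of the `Δ`-Dixmier–Moeglin equivalence for a noetherian `R`
with `dim_k R < |k|` and `|Δ| < |k|`. -/
theorem deltaDME_tfae (k R : Type u) [Field k] [CharZero k] [CommRing R]
    [Algebra k R] [IsNoetherianRing R]
    (hrank : Module.rank k R < Cardinal.mk k)
    (Δ : Set (Derivation k R R)) (hΔ : Cardinal.mk Δ < Cardinal.mk k) :
    List.TFAE [
      DeltaDME k R Δ,
      ∀ (P : PrimeSpectrum R) (hP : IsDeltaIdeal k R Δ P.asIdeal),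
        IsDeltaRational k R Δ P.asIdeal P.isPrime →
        IsLocallyClosed ({⟨P, hP⟩} : Set (DeltaSpec k R Δ)),
      ∀ (P : PrimeSpectrum R) (hP : IsDeltaIdeal k R Δ P.asIdeal),
        IsDeltaPrimitive k R Δ P.asIdeal →
        IsLocallyClosed ({⟨P, hP⟩} : Set (DeltaSpec k R Δ)),
      ∀ P : Ideal R, IsDeltaPrime k R Δ P →
        DeltaSeparable k R Δ (Cardinal.mk k) P → DeltaSeparable k R Δ Cardinal.aleph0 P] := by
  have hinf : Cardinal.aleph0 ≤ Cardinal.mk k :=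
    have : Infinite k := Infinite.of_injective _ (Nat.cast_injective (R := k))
    Cardinal.aleph0_le_mk k
  have sep_mono : ∀ P : Ideal R, DeltaSeparable k R Δ Cardinal.aleph0 P →
      DeltaSeparable k R Δ (Cardinal.mk k) P :=
    fun P ⟨Λ, h1, h2, h3⟩ => ⟨Λ, h1, h2.trans_le hinf, h3⟩
  have closed_primitive : ∀ (P : PrimeSpectrum R) (hP : IsDeltaIdeal k R Δ P.asIdeal),
      IsLocallyClosed ({⟨P, hP⟩} : Set (DeltaSpec k R Δ)) → IsDeltaPrimitive k R Δ P.asIdeal :=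
    fun P hP h => DeltaSeparable.isDeltaPrimitive hrank ⟨P.isPrime, hP⟩
      (sep_mono _ ((isLocallyClosed_singleton_iff_deltaSeparable P hP).1 h))
  tfae_have 1 → 2 := fun h P hP hrat => (h P hP).1.2 ((h P hP).2.2 hrat)
  tfae_have 2 → 1 := fun h P hP =>
    ⟨⟨closed_primitive P hP, fun hprim => h P hP (hprim.isDeltaRational hrank hP)⟩,
      fun hprim => hprim.isDeltaRational hrank hP,
      fun hrat => closed_primitive P hP (h P hP hrat)⟩
  tfae_have 2 → 3 := fun h P hP hprim => h P hP (hprim.isDeltaRational hrank hP)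
  tfae_have 3 → 4 := fun h P hP hsep =>
    (isLocallyClosed_singleton_iff_deltaSeparable ⟨P, hP.1⟩ hP.2).1
      (h ⟨P, hP.1⟩ hP.2 (hsep.isDeltaPrimitive hrank hP))
  tfae_have 4 → 2 := fun h P hP hrat =>
    (isLocallyClosed_singleton_iff_deltaSeparable P hP).2
      (h P.asIdeal ⟨P.isPrime, hP⟩ (hrat.deltaSeparable hrank hP))
  tfae_finish
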